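/- Let (A_1, …, A_k) be a tuple of closed subsets of X which has an independence set of positive density. Then there exists an IE-tuple (x_1, …, x_k) with x_j ∈ A_j for all 1 ≤ j ≤ k. -/

import Mathlib

open Filter Set

/-- `J ⊆ ℕ` is an independence set for the tuple `A = (A 0, …, A (k-1))` of subsets of `X`
with respect to the map `T`. -/
def IsIndepSet {X : Type*} (T : X → X) {k : ℕ} (A : Fin k → Set X) (J : Set ℕ) : Prop :=
  ∀ I : Finset ℕ, I.Nonempty → ↑I ⊆ J → ∀ σ : ℕ → Fin k,
    (⋂ s ∈ I, T^[s] ⁻¹' A (σ s)).Nonempty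

/-- `J ⊆ ℕ` has positive density: the limit of `|J ∩ {0,…,n}| / (n+1)` exists and is nonzero. -/
def HasPosDensity (J : Set ℕ) : Prop :=
  ∃ d : ℝ, d ≠ 0 ∧
    Tendsto (fun n : ℕ => (Nat.card (J ∩ Set.Iic n : Set ℕ) : ℝ) / (n + 1)) atTop (nhds d)

/-- The tuple `A` has an independence set of positive density. -/
def HasIndepSetPosDensity {X : Type*} (T : X → X) {k : ℕ} (A : Fin k → Set X) : Prop :=
  ∃ J : Set ℕ, IsIndepSet T A J ∧ HasPosDensity J

/-- `x` is an IE-tuple: every product neighbourhood of `x` has an independence set of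
positive density. -/
def IsIETuple {X : Type*} [TopologicalSpace X] (T : X → X) {k : ℕ} (x : Fin k → X) : Prop :=
  ∀ U : Fin k → Set X, (∀ i, IsOpen (U i)) → (∀ i, x i ∈ U i) →
    HasIndepSetPosDensity T U

open scoped Classical in
theorem hasPosDensity_iff_tendsto_count (J : Set ℕ) :
    HasPosDensity J ↔ ∃ d : ℝ, d ≠ 0 ∧
      Tendsto (fun n : ℕ => (Nat.count (· ∈ J) n : ℝ) / n) atTop (nhds d) := by
  have key : ∀ n : ℕ, Nat.card (J ∩ Set.Iic n : Set ℕ) = Nat.count (· ∈ J) (n + 1) := by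
    intro n
    rw [Nat.count_eq_card_filter_range, Nat.card_coe_set_eq, ← Set.ncard_coe_finset]
    congr 1
    ext s
    simp [and_comm]
  refine exists_congr fun d => and_congr_right fun _ => ?_
  rw [← tendsto_add_atTop_iff_nat (f := fun n : ℕ => (Nat.count (· ∈ J) n : ℝ) / n) 1]
  simp only [key, Nat.cast_add, Nat.cast_one]

/-- A property of subsets of `ℕ` which passes to subsets, is determined by finite subsets and is
invariant under translation to the left. -/
structure IsShiftProperty (P : Set ℕ → Prop) : Prop where
  mono : ∀ {J K : Set ℕ}, K ⊆ J → P J → P K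
  finitary : ∀ {J : Set ℕ}, (∀ F : Finset ℕ, ↑F ⊆ J → P F) → P J
  shift : ∀ {J : Set ℕ} (a : ℕ), P J → P {s | a + s ∈ J}

open scoped Classical in
/-- The largest number of elements below `n` of a set satisfying `P`. -/
noncomputable def maxCount (P : Set ℕ → Prop) (n : ℕ) : ℕ :=
  sSup {c | ∃ J, P J ∧ Nat.count (· ∈ J) n = c}

section Density

open scoped Classical

variable {P : Set ℕ → Prop}

theorem bddAbove_count (P : Set ℕ → Prop) (n : ℕ) :
    BddAbove {c | ∃ J, P J ∧ Nat.count (· ∈ J) n = c} := by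
  refine ⟨n, ?_⟩
  rintro _ ⟨J, -, rfl⟩
  exact Nat.count_le _

theorem count_le_maxCount {J : Set ℕ} (hJ : P J) (n : ℕ) :
    Nat.count (· ∈ J) n ≤ maxCount P n :=
  le_csSup (bddAbove_count P n) ⟨J, hJ, rfl⟩

theorem exists_count_eq_maxCount (hne : ∃ J, P J) (n : ℕ) :
    ∃ J, P J ∧ Nat.count (· ∈ J) n = maxCount P n := by
  obtain ⟨J, hJ⟩ := hne
  exact Nat.sSup_mem (s := {c | ∃ J, P J ∧ Nat.count (· ∈ J) n = c})
    ⟨_, J, hJ, rfl⟩ (bddAbove_count P n)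

theorem count_mem_add (J : Set ℕ) (a b : ℕ) :
    Nat.count (· ∈ J) (a + b) = Nat.count (· ∈ J) a + Nat.count (· ∈ {s | a + s ∈ J}) b := by
  simp [Nat.count_add]

theorem subadditive_maxCount (hP : IsShiftProperty P) (hne : ∃ J, P J) :
    Subadditive (fun n => (maxCount P n : ℝ)) := by
  intro m n
  beta_reduce
  obtain ⟨J, hJ, hc⟩ := exists_count_eq_maxCount hne (m + n)
  have h1 := count_le_maxCount hJ m
  have h2 := count_le_maxCount (hP.shift m hJ) n
  rw [count_mem_add] at hc
  exact_mod_cast (by omega : maxCount P (m + n) ≤ maxCount P m + maxCount P n)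

theorem exists_count_ge_of_lt (hP : IsShiftProperty P) (hne : ∃ J, P J) {d e : ℝ} (he : 0 ≤ e)
    (hed : e < d) (hd : ∀ n : ℕ, d * n ≤ maxCount P n) (N : ℕ) :
    ∃ J, P J ∧ ∀ n ≤ N, e * n ≤ Nat.count (· ∈ J) n := by
  by_contra! hcon
  have bound : ∀ M : ℕ, ∀ J, P J → (Nat.count (· ∈ J) M : ℝ) ≤ e * M + N := by
    intro M
    induction M using Nat.strong_induction_on with
    | _ M ih =>
      intro J hJ
      obtain ⟨n, hnN, hn⟩ := hcon J hJ
      rcases le_or_gt M N with hM | hM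
      · have h1 : (Nat.count (· ∈ J) M : ℝ) ≤ M := by exact_mod_cast Nat.count_le _
        have h2 : (M : ℝ) ≤ N := by exact_mod_cast hM
        have : 0 ≤ e * M := by positivity
        linarith
      · have hn0 : 0 < n := by
          rcases Nat.eq_zero_or_pos n with rfl | h
          · simp at hn
          · exact h
        obtain ⟨r, rfl⟩ : ∃ r, M = n + r := ⟨M - n, by omega⟩
        have := ih r (by omega) _ (hP.shift n hJ)
        rw [count_mem_add]
        push_cast
        linarith
  obtain ⟨M, hM⟩ := exists_nat_gt ((N : ℝ) / (d - e))
  rw [div_lt_iff₀ (by linarith)] at hM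
  obtain ⟨J, hJ, hc⟩ := exists_count_eq_maxCount hne M
  have h1 := bound M J hJ
  have h2 := hd M
  rw [← hc] at h2
  linarith

theorem exists_count_ge (hP : IsShiftProperty P) (hne : ∃ J, P J) {d : ℝ} (hd0 : 0 < d)
    (hd : ∀ n : ℕ, d * n ≤ maxCount P n) :
    ∃ J, P J ∧ ∀ n : ℕ, d * n ≤ Nat.count (· ∈ J) n := by
  have step : ∀ N : ℕ, ∃ J, P J ∧ ∀ n ≤ N,
      (d - d * (1 / ((N : ℝ) + 1))) * n ≤ Nat.count (· ∈ J) n := by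
    intro N
    have h1 : (1 : ℝ) / ((N : ℝ) + 1) ≤ 1 := by
      rw [div_le_one (by positivity)]
      linarith [(Nat.cast_nonneg N : (0 : ℝ) ≤ N)]
    have h2 : (0 : ℝ) < 1 / ((N : ℝ) + 1) := by positivity
    exact exists_count_ge_of_lt hP hne (by nlinarith) (by nlinarith) hd N
  choose K hK hKc using step
  let J : Set ℕ := {s | ∀ᶠ N in (hyperfilter ℕ : Filter ℕ), s ∈ K N}
  have hle : (hyperfilter ℕ : Filter ℕ) ≤ atTop := Nat.hyperfilter_le_atTop
  refine ⟨J, hP.finitary fun F hF => ?_, fun n => ?_⟩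
  · have : ∀ᶠ N in (hyperfilter ℕ : Filter ℕ), ∀ s ∈ F, s ∈ K N :=
      (Finset.eventually_all F).2 fun s hs => hF hs
    obtain ⟨N, hN⟩ := this.exists
    exact hP.mono hN (hK N)
  · have agree : ∀ᶠ N in (hyperfilter ℕ : Filter ℕ), ∀ s ∈ Finset.range n, (s ∈ K N → s ∈ J) := by
      refine (Finset.eventually_all _).2 fun s _ => ?_
      by_cases hs : s ∈ J
      · exact Eventually.of_forall fun _ _ => hs
      · have : ∀ᶠ N in (hyperfilter ℕ : Filter ℕ), ¬ s ∈ K N := Ultrafilter.eventually_not.2 hs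
        exact this.mono fun N h h' => absurd h' h
    have lim : Tendsto (fun N : ℕ => (d - d * (1 / ((N : ℝ) + 1))) * n)
        (hyperfilter ℕ : Filter ℕ) (nhds ((d - d * 0) * n)) :=
      (((tendsto_one_div_add_atTop_nhds_zero_nat.const_mul d).const_sub d).mul_const _).mono_left hle
    have : (d - d * 0) * n ≤ Nat.count (· ∈ J) n := by
      refine le_of_tendsto lim ?_
      filter_upwards [agree, hle (eventually_ge_atTop n)] with N hN hnN
      refine (hKc N n hnN).trans ?_
      rw [Nat.count_eq_card_filter_range, Nat.count_eq_card_filter_range]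
      exact_mod_cast Finset.card_le_card fun s hs => by
        rw [Finset.mem_filter] at hs ⊢
        exact ⟨hs.1, hN s hs.1 hs.2⟩
    simpa using this

/-- If `P` is satisfied by sets of large relative size in infinitely many initial intervals, then
`P` is satisfied by a set of positive density. -/
theorem IsShiftProperty.exists_hasPosDensity (hP : IsShiftProperty P) {c : ℝ} (hc : 0 < c)
    (h : ∃ᶠ n : ℕ in atTop, ∃ J, P J ∧ c * n ≤ Nat.count (· ∈ J) n) :
    ∃ J, P J ∧ HasPosDensity J := by
  have hne : ∃ J, P J := by
    obtain ⟨_, J, hJ, -⟩ := h.exists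
    exact ⟨J, hJ⟩
  have hsub := subadditive_maxCount hP hne
  have hbdd : BddBelow (range fun n : ℕ => (maxCount P n : ℝ) / n) :=
    ⟨0, by rintro _ ⟨n, rfl⟩; positivity⟩
  have hlim := hsub.tendsto_lim hbdd
  have hcd : c ≤ hsub.lim := by
    refine ge_of_tendsto_of_frequently hlim ?_
    refine (h.and_eventually (eventually_gt_atTop 0)).mono ?_
    rintro n ⟨⟨J, hJ, hn⟩, hn0⟩
    rw [le_div_iff₀ (by exact_mod_cast hn0)]
    exact hn.trans (by exact_mod_cast count_le_maxCount hJ n)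
  have hd : ∀ n : ℕ, hsub.lim * n ≤ maxCount P n := by
    intro n
    rcases Nat.eq_zero_or_pos n with rfl | hn
    · simp
    · rw [← le_div_iff₀ (by exact_mod_cast hn)]
      exact hsub.lim_le_div hbdd hn.ne'
  obtain ⟨J, hJ, hJc⟩ := exists_count_ge hP hne (hc.trans_le hcd) hd
  refine ⟨J, hJ, (hasPosDensity_iff_tendsto_count J).2 ⟨hsub.lim, (hc.trans_le hcd).ne', ?_⟩⟩
  refine tendsto_of_tendsto_of_tendsto_of_le_of_le' tendsto_const_nhds hlim ?_ ?_
  · filter_upwards [eventually_gt_atTop 0] with n hn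
    rw [le_div_iff₀ (by exact_mod_cast hn)]
    exact hJc n
  · refine Eventually.of_forall fun n => ?_
    have := count_le_maxCount hJ n
    gcongr

end Density

section Shattering

open scoped Classical

variable {X : Type*} {k : ℕ}

/-- The total weight of the words `σ : Fin n → Fin k` such that some point of `Y` lies in
`A z (σ z)` for all `z`, where each letter `i` has weight `w i`. -/
noncomputable def wordWeight (w : Fin k → ℝ) {n : ℕ} (A : Fin n → Fin k → Set X) (Y : Set X) : ℝ :=
  ∑ σ : Fin n → Fin k, (∏ z, w (σ z)) * if ∃ y ∈ Y, ∀ z, y ∈ A z (σ z) then 1 else 0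

/-- The set `Y` shatters `τ` if every word over `Fin k` is realised by a point of `Y` on the domain
of `τ`, where the coordinate `z` uses the sets `D (τ z) z`. -/
def Shatters {n : ℕ} (D : Bool → Fin n → Fin k → Set X) (τ : Fin n → Option Bool) (Y : Set X) :
    Prop :=
  ∀ σ : Fin n → Fin k, ∃ y ∈ Y, ∀ z b, τ z = some b → y ∈ D b z (σ z)

theorem sum_fin_cons {α : Type*} [Fintype α] {n : ℕ} (f : (Fin (n + 1) → α) → ℝ) :
    ∑ σ, f σ = ∑ a, ∑ τ : Fin n → α, f (Fin.cons a τ) := by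
  rw [← (Fin.consEquiv fun _ : Fin (n + 1) => α).sum_comp f, Fintype.sum_prod_type]
  rfl

theorem wordWeight_succ (w : Fin k → ℝ) {n : ℕ} (A : Fin (n + 1) → Fin k → Set X) (Y : Set X) :
    wordWeight w A Y = ∑ i, w i * wordWeight w (fun z => A z.succ) (Y ∩ A 0 i) := by
  unfold wordWeight
  rw [sum_fin_cons]
  refine Finset.sum_congr rfl fun i _ => ?_
  rw [Finset.mul_sum]
  refine Finset.sum_congr rfl fun σ _ => ?_
  simp only [Fin.prod_univ_succ, Fin.cons_zero, Fin.cons_succ, Fin.forall_fin_succ, mem_inter_iff,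
    and_assoc, mul_assoc]

theorem wordWeight_union_le {w : Fin k → ℝ} (hw : ∀ i, 0 ≤ w i) {n : ℕ}
    (A : Fin n → Fin k → Set X) {Y Y₁ Y₂ : Set X} (hY : Y ⊆ Y₁ ∪ Y₂) :
    wordWeight w A Y ≤ wordWeight w A Y₁ + wordWeight w A Y₂ := by
  unfold wordWeight
  rw [← Finset.sum_add_distrib]
  refine Finset.sum_le_sum fun σ _ => ?_
  rw [← mul_add]
  refine mul_le_mul_of_nonneg_left ?_ (Finset.prod_nonneg fun _ _ => hw _)
  by_cases h : ∃ y ∈ Y, ∀ z, y ∈ A z (σ z)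
  · obtain ⟨y, hy, hyA⟩ := h
    rcases hY hy with h' | h'
    · rw [if_pos ⟨y, hy, hyA⟩, if_pos ⟨y, h', hyA⟩]
      split_ifs <;> norm_num
    · rw [if_pos ⟨y, hy, hyA⟩, if_pos (c := ∃ y ∈ Y₂, ∀ z, y ∈ A z (σ z)) ⟨y, h', hyA⟩]
      split_ifs <;> norm_num
  · rw [if_neg h]
    split_ifs <;> norm_num

theorem Shatters.mono {n : ℕ} {D : Bool → Fin n → Fin k → Set X} {τ : Fin n → Option Bool}
    {Y Z : Set X} (hYZ : Y ⊆ Z) (h : Shatters D τ Y) : Shatters D τ Z := fun σ => by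
  obtain ⟨y, hy, hyD⟩ := h σ
  exact ⟨y, hYZ hy, hyD⟩

theorem Shatters.cons_none {n : ℕ} {D : Bool → Fin (n + 1) → Fin k → Set X}
    {τ : Fin n → Option Bool} {Y : Set X} (h : Shatters (fun b z => D b z.succ) τ Y) :
    Shatters D (Fin.cons none τ : Fin (n + 1) → Option Bool) Y := fun σ => by
  obtain ⟨y, hy, hyD⟩ := h (fun z => σ z.succ)
  refine ⟨y, hy, Fin.cases (by simp) fun z b hb => hyD z b (by simpa using hb)⟩

theorem Shatters.cons_some {n : ℕ} {D : Bool → Fin (n + 1) → Fin k → Set X}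
    {τ : Fin n → Option Bool} {Y : Set X} {b : Bool}
    (h : ∀ i, Shatters (fun b z => D b z.succ) τ (Y ∩ D b 0 i)) :
    Shatters D (Fin.cons (some b) τ : Fin (n + 1) → Option Bool) Y := fun σ => by
  obtain ⟨y, hy, hyD⟩ := h (σ 0) (fun z => σ z.succ)
  refine ⟨y, hy.1, Fin.cases ?_ fun z b' hb => hyD z b' (by simpa using hb)⟩
  intro b' hb
  obtain rfl : b = b' := by simpa using hb
  exact hy.2

/-- A weighted Sauer–Shelah inequality: words realised by `Y` are controlled by shattered partial
types when the letter `i₀` is split in two. -/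
theorem wordWeight_le_sum_shatters (i₀ : Fin k) {w : Fin k → ℝ} (hw₀ : w i₀ = 1 / 2)
    (hw : ∀ i, i ≠ i₀ → w i = 1) {v : Option Bool → ℝ} (hv₀ : v none = k - 1)
    (hv : ∀ b, v (some b) = 1 / 2) {n : ℕ}
    (A : Fin n → Fin k → Set X) (D : Bool → Fin n → Fin k → Set X)
    (h₀ : ∀ z, A z i₀ ⊆ D true z i₀ ∪ D false z i₀)
    (h₁ : ∀ b z i, i ≠ i₀ → A z i = D b z i) (Y : Set X) :
    wordWeight w A Y ≤
      ∑ τ : Fin n → Option Bool, (∏ z, v (τ z)) * if Shatters D τ Y then 1 else 0 := by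
  have hw_nonneg : ∀ i, 0 ≤ w i := fun i => by
    by_cases hi : i = i₀
    · rw [hi, hw₀]; norm_num
    · rw [hw i hi]; norm_num
  have hk : (1 : ℝ) ≤ k := by exact_mod_cast i₀.pos
  have hv_nonneg : ∀ a, 0 ≤ v a := by
    rintro (_ | b)
    · rw [hv₀]; linarith
    · rw [hv]; norm_num
  induction n generalizing Y with
  | zero => simp [wordWeight, Shatters]
  | succ n ih =>
    set A' : Fin n → Fin k → Set X := fun z => A z.succ
    set D' : Bool → Fin n → Fin k → Set X := fun b z => D b z.succ
    have ih' := fun Y => ih A' D' (fun z => h₀ z.succ) (fun b z => h₁ b z.succ) Y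
    set S : (Fin n → Option Bool) → Set X → ℝ := fun τ Y => if Shatters D' τ Y then 1 else 0
      with hS
    have hS1 : ∀ τ Y, S τ Y ≤ 1 := fun τ Y => by simp only [hS]; split_ifs <;> norm_num
    have pointwise : ∀ τ, (1 / 2) * (S τ (Y ∩ D true 0 i₀) + S τ (Y ∩ D false 0 i₀)) +
        ∑ i ∈ Finset.univ.erase i₀, S τ (Y ∩ A 0 i) ≤
        ∑ a, v a * if Shatters D (Fin.cons a τ : Fin (n + 1) → Option Bool) Y then 1 else 0 := by
      intro τ
      have hcard : ((Finset.univ.erase i₀ : Finset (Fin k)).card : ℝ) = k - 1 := by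
        rw [Finset.card_erase_of_mem (Finset.mem_univ _), Finset.card_univ, Fintype.card_fin,
          Nat.cast_sub i₀.pos, Nat.cast_one]
      rw [Fintype.sum_option, Fintype.sum_bool, hv₀, hv, hv]
      by_cases hany : Shatters D' τ Y
      · rw [if_pos hany.cons_none]
        by_cases hall : ∀ i, i ≠ i₀ → Shatters D' τ (Y ∩ A 0 i)
        · have hb : ∀ b, S τ (Y ∩ D b 0 i₀) ≤
              if Shatters D (Fin.cons (some b) τ : Fin (n + 1) → Option Bool) Y then 1 else 0 := by
            intro b
            by_cases hb : Shatters D' τ (Y ∩ D b 0 i₀)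
            · rw [if_pos]
              · exact hS1 _ _
              · refine Shatters.cons_some fun i => ?_
                by_cases hi : i = i₀
                · rw [hi]; exact hb
                · rw [← h₁ b 0 i hi]; exact hall i hi
            · simp only [hS]
              rw [if_neg hb]
              split_ifs <;> norm_num
          have hsum : ∑ i ∈ Finset.univ.erase i₀, S τ (Y ∩ A 0 i) ≤ k - 1 := by
            rw [← hcard]
            refine (Finset.sum_le_card_nsmul _ _ 1 fun i _ => hS1 τ (Y ∩ A 0 i)).trans_eq ?_
            rw [nsmul_eq_mul, mul_one]
          linarith [hb true, hb false]
        · push Not at hall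
          obtain ⟨i, hi, hni⟩ := hall
          have hsum : ∑ i ∈ Finset.univ.erase i₀, S τ (Y ∩ A 0 i) ≤ k - 2 := by
            have hmem : i ∈ Finset.univ.erase i₀ := by simp [hi]
            rw [← Finset.add_sum_erase _ _ hmem]
            have h0 : S τ (Y ∩ A 0 i) = 0 := if_neg hni
            have hle : ∑ j ∈ (Finset.univ.erase i₀).erase i, S τ (Y ∩ A 0 j) ≤
                ((Finset.univ.erase i₀).erase i).card := by
              refine (Finset.sum_le_card_nsmul _ _ 1 fun i _ => hS1 τ (Y ∩ A 0 i)).trans_eq ?_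
              rw [nsmul_eq_mul, mul_one]
            have hc := Finset.card_erase_add_one hmem
            have hc' : (((Finset.univ.erase i₀).erase i).card : ℝ) + 1 = k - 1 := by
              rw [← hcard]; exact_mod_cast hc
            linarith
          have e1 : (0 : ℝ) ≤
            if Shatters D (Fin.cons (some true) τ : Fin (n + 1) → Option Bool) Y then 1 else 0 := by
            split_ifs <;> norm_num
          have e2 : (0 : ℝ) ≤
            if Shatters D (Fin.cons (some false) τ : Fin (n + 1) → Option Bool) Y then 1 else 0 := by
            split_ifs <;> norm_num
          linarith [hS1 τ (Y ∩ D true 0 i₀), hS1 τ (Y ∩ D false 0 i₀)]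
      · have hz : ∀ Z, S τ (Y ∩ Z) = 0 := fun Z =>
          if_neg fun h => hany (h.mono inter_subset_left)
        simp only [hz, Finset.sum_const_zero]
        have hk' : (0 : ℝ) ≤ k - 1 := by linarith
        have : (0 : ℝ) ≤ (k - 1 : ℝ) *
            if Shatters D (Fin.cons none τ : Fin (n + 1) → Option Bool) Y then 1 else 0 :=
          mul_nonneg hk' (by split_ifs <;> norm_num)
        split_ifs at this ⊢ <;> norm_num at this ⊢ <;> linarith
    have hsplit : wordWeight w A' (Y ∩ A 0 i₀) ≤
        wordWeight w A' (Y ∩ D true 0 i₀) + wordWeight w A' (Y ∩ D false 0 i₀) :=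
      wordWeight_union_le hw_nonneg _ <| by
        rw [← inter_union_distrib_left]
        exact inter_subset_inter_right _ (h₀ 0)
    have hrest : ∑ i ∈ Finset.univ.erase i₀, w i * wordWeight w A' (Y ∩ A 0 i) ≤
        ∑ i ∈ Finset.univ.erase i₀, ∑ τ, (∏ z, v (τ z)) * S τ (Y ∩ A 0 i) := by
      refine Finset.sum_le_sum fun i hi => ?_
      rw [hw i (Finset.ne_of_mem_erase hi), one_mul]
      exact ih' _
    calc wordWeight w A Y
        = w i₀ * wordWeight w A' (Y ∩ A 0 i₀) +
            ∑ i ∈ Finset.univ.erase i₀, w i * wordWeight w A' (Y ∩ A 0 i) := by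
          rw [wordWeight_succ]
          exact (Finset.add_sum_erase _ (fun i => w i * wordWeight w A' (Y ∩ A 0 i))
            (Finset.mem_univ i₀)).symm
      _ ≤ (1 / 2) * (∑ τ, (∏ z, v (τ z)) * S τ (Y ∩ D true 0 i₀) +
              ∑ τ, (∏ z, v (τ z)) * S τ (Y ∩ D false 0 i₀)) +
            ∑ i ∈ Finset.univ.erase i₀, ∑ τ, (∏ z, v (τ z)) * S τ (Y ∩ A 0 i) := by
          rw [hw₀]
          linarith [ih' (Y ∩ D true 0 i₀), ih' (Y ∩ D false 0 i₀)]
      _ = ∑ τ, (∏ z, v (τ z)) * ((1 / 2) * (S τ (Y ∩ D true 0 i₀) + S τ (Y ∩ D false 0 i₀)) +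
            ∑ i ∈ Finset.univ.erase i₀, S τ (Y ∩ A 0 i)) := by
          rw [Finset.sum_comm, ← Finset.sum_add_distrib, Finset.mul_sum, ← Finset.sum_add_distrib]
          refine Finset.sum_congr rfl fun τ _ => ?_
          rw [← Finset.mul_sum]
          ring
      _ ≤ ∑ τ : Fin n → Option Bool, (∏ z, v (τ z)) *
            ∑ a, v a * if Shatters D (Fin.cons a τ : Fin (n + 1) → Option Bool) Y then 1 else 0 :=
          Finset.sum_le_sum fun τ _ => mul_le_mul_of_nonneg_left (pointwise τ)
            (Finset.prod_nonneg fun _ _ => hv_nonneg _)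
      _ = _ := by
          rw [sum_fin_cons, Finset.sum_comm]
          refine Finset.sum_congr rfl fun τ _ => ?_
          rw [Finset.mul_sum]
          refine Finset.sum_congr rfl fun a _ => ?_
          simp only [Fin.prod_univ_succ, Fin.cons_zero, Fin.cons_succ]
          ring

theorem exists_pow_gap (k : ℕ) (hk : 1 ≤ k) :
    ∃ M : ℕ, 0 < M ∧ 4 * ((k : ℝ) - 3 / 4) ^ M < ((k : ℝ) - 1 / 2) ^ M := by
  have hk' : (1 : ℝ) ≤ k := by exact_mod_cast hk
  have h1 : (0 : ℝ) < k - 3 / 4 := by linarith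
  have h2 : 1 < ((k : ℝ) - 1 / 2) / (k - 3 / 4) := by
    rw [one_lt_div h1]; linarith
  obtain ⟨M, hM⟩ := pow_unbounded_of_one_lt 4 h2
  refine ⟨M, Nat.pos_of_ne_zero ?_, ?_⟩
  · rintro rfl
    norm_num at hM
  · rwa [div_pow, lt_div_iff₀ (by positivity)] at hM

/-- If all words are realised and the letter `i₀` is split in two, then a partial type is shattered
on a fixed proportion of the coordinates. -/
theorem exists_shatters_card (i₀ : Fin k) {M : ℕ} (hM0 : 0 < M)
    (hM : 4 * ((k : ℝ) - 3 / 4) ^ M < ((k : ℝ) - 1 / 2) ^ M) {n : ℕ} (hn : 0 < n)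
    (A : Fin n → Fin k → Set X) (D : Bool → Fin n → Fin k → Set X)
    (h₀ : ∀ z, A z i₀ ⊆ D true z i₀ ∪ D false z i₀)
    (h₁ : ∀ b z i, i ≠ i₀ → A z i = D b z i)
    (hA : ∀ σ : Fin n → Fin k, ∃ y, ∀ z, y ∈ A z (σ z)) :
    ∃ τ : Fin n → Option Bool, Shatters D τ univ ∧
      n ≤ M * (Finset.univ.filter fun z => τ z ≠ none).card := by
  by_contra! hcon
  have hk : (1 : ℝ) ≤ k := by exact_mod_cast i₀.pos
  let w : Fin k → ℝ := fun i => if i = i₀ then 1 / 2 else 1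
  let v : Option Bool → ℝ := fun a => a.elim (k - 1) fun _ => 1 / 2
  let v' : Option Bool → ℝ := fun a => a.elim (k - 1) fun _ => 1 / 8
  have hv' : ∀ a, 0 ≤ v' a := by
    rintro (_ | b)
    · simpa [v'] using hk
    · simp [v']
  have hvv' : ∀ a, v a = (if a ≠ none then 4 else 1) * v' a := by
    rintro (_ | b)
    · simp [v, v']
    · simp [v, v']; norm_num
  have hword : wordWeight w A univ = ((k : ℝ) - 1 / 2) ^ n := by
    have : ∀ σ : Fin n → Fin k, ∃ y ∈ (univ : Set X), ∀ z, y ∈ A z (σ z) := fun σ => by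
      simpa using hA σ
    unfold wordWeight
    simp only [this, if_true, mul_one]
    have hw : ∑ i, w i = (k : ℝ) - 1 / 2 := by
      rw [← Finset.add_sum_erase _ _ (Finset.mem_univ i₀),
        Finset.sum_congr rfl (g := fun _ => (1 : ℝ)) fun i hi =>
          if_neg (Finset.ne_of_mem_erase hi)]
      simp only [w, if_true, Finset.sum_const, Finset.card_erase_of_mem (Finset.mem_univ i₀),
        Finset.card_univ, Fintype.card_fin, nsmul_eq_mul, mul_one, Nat.cast_sub i₀.pos,
        Nat.cast_one]
      ring
    rw [← hw, Fintype.sum_pow]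
  have hle := wordWeight_le_sum_shatters i₀ (w := w) (by simp [w]) (fun i hi => by simp [w, hi])
    (v := v) rfl (fun _ => rfl) A D h₀ h₁ univ
  have hsum : ∑ τ : Fin n → Option Bool, (∏ z, v (τ z)) * (if Shatters D τ univ then 1 else 0) ≤
      4 ^ (n / M) * ((k : ℝ) - 3 / 4) ^ n := by
    have hv'sum : ∑ a, v' a = (k : ℝ) - 3 / 4 := by
      simp [v', Fintype.sum_option]; ring
    rw [← hv'sum, Fintype.sum_pow, Finset.mul_sum]
    refine Finset.sum_le_sum fun τ _ => ?_
    have hp : 0 ≤ ∏ z, v' (τ z) := Finset.prod_nonneg fun _ _ => hv' _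
    by_cases hτ : Shatters D τ univ
    · rw [if_pos hτ, mul_one]
      simp only [hvv', Finset.prod_mul_distrib]
      refine mul_le_mul_of_nonneg_right ?_ hp
      rw [← Finset.prod_filter, Finset.prod_const]
      refine pow_le_pow_right₀ (by norm_num) ?_
      rw [Nat.le_div_iff_mul_le hM0, mul_comm]
      exact (hcon τ hτ).le
    · rw [if_neg hτ, mul_zero]
      positivity
  rw [hword] at hle
  have h34 : (0 : ℝ) ≤ k - 3 / 4 := by linarith
  have h12 : (0 : ℝ) ≤ k - 1 / 2 := by linarith
  have hpow := pow_le_pow_left₀ (pow_nonneg h12 n) (hle.trans hsum) M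
  have hlt := pow_lt_pow_left₀ hM (by positivity) hn.ne'
  have h4 : ((4 : ℝ) ^ (n / M)) ^ M ≤ 4 ^ n := by
    rw [← pow_mul]
    exact pow_le_pow_right₀ (by norm_num) (Nat.div_mul_le_self n M)
  have : (((k : ℝ) - 1 / 2) ^ n) ^ M < (((k : ℝ) - 1 / 2) ^ M) ^ n := by
    refine hpow.trans_lt (lt_of_le_of_lt ?_ hlt)
    rw [mul_pow, mul_pow, ← pow_mul ((k : ℝ) - 3 / 4), ← pow_mul ((k : ℝ) - 3 / 4), mul_comm n M]
    exact mul_le_mul_of_nonneg_right h4 (by positivity)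
  rw [← pow_mul, ← pow_mul, mul_comm] at this
  exact lt_irrefl _ this

end Shattering

section Independence

open scoped Classical

variable {X : Type*} {T : X → X} {k : ℕ}

theorem isShiftProperty_isIndepSet (T : X → X) (A : Fin k → Set X) :
    IsShiftProperty (IsIndepSet T A) where
  mono hKJ hJ I hI hIK σ := hJ I hI (hIK.trans hKJ) σ
  finitary h I hI hIJ σ := h I hIJ I hI subset_rfl σ
  shift {J} a hJ I hI hIJ σ := by
    obtain ⟨x, hx⟩ := hJ (I.image (a + ·)) (hI.image _)
      (by simpa [Set.subset_def] using hIJ) (fun s => σ (s - a))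
    refine ⟨T^[a] x, ?_⟩
    simp only [mem_iInter, mem_preimage, Finset.mem_image, forall_exists_index, and_imp,
      forall_apply_eq_imp_iff₂] at hx ⊢
    intro s hs
    have := hx s hs
    rwa [Nat.add_sub_cancel_left, add_comm, Function.iterate_add_apply] at this

theorem HasIndepSetPosDensity.mono {A B : Fin k → Set X} (hAB : ∀ i, A i ⊆ B i)
    (h : HasIndepSetPosDensity T A) : HasIndepSetPosDensity T B := by
  obtain ⟨J, hJ, hd⟩ := h
  refine ⟨J, fun I hI hIJ σ => (hJ I hI hIJ σ).mono ?_, hd⟩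
  exact iInter₂_mono fun s _ => preimage_mono (hAB _)

theorem HasIndepSetPosDensity.nonempty {A : Fin k → Set X} (h : HasIndepSetPosDensity T A)
    (i : Fin k) : (A i).Nonempty := by
  obtain ⟨J, hJ, hd⟩ := h
  obtain ⟨s, hs⟩ : J.Nonempty := by
    by_contra hJe
    rw [not_nonempty_iff_eq_empty] at hJe
    obtain ⟨d, hd0, hd⟩ := hd
    simp only [hJe, empty_inter, Nat.card_of_isEmpty, Nat.cast_zero, zero_div] at hd
    exact hd0 (tendsto_nhds_unique hd tendsto_const_nhds)
  obtain ⟨x, hx⟩ := hJ {s} (by simp) (by simpa using hs) fun _ => i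
  exact ⟨T^[s] x, by simpa using hx⟩

theorem HasIndepSetPosDensity.eventually_count {A : Fin k → Set X}
    (h : HasIndepSetPosDensity T A) :
    ∃ J, IsIndepSet T A J ∧ ∃ c : ℝ, 0 < c ∧ ∀ᶠ n : ℕ in atTop, c * n ≤ Nat.count (· ∈ J) n := by
  obtain ⟨J, hJ, hd⟩ := h
  obtain ⟨d, hd0, hlim⟩ := (hasPosDensity_iff_tendsto_count J).1 hd
  have hdpos : 0 < d :=
    lt_of_le_of_ne (ge_of_tendsto' hlim fun n => by positivity) hd0.symm
  refine ⟨J, hJ, d / 2, by positivity, ?_⟩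
  filter_upwards [hlim.eventually (lt_mem_nhds (half_lt_self hdpos)), eventually_gt_atTop 0]
    with n hn hn0
  exact ((lt_div_iff₀ (by exact_mod_cast hn0)).1 hn).le

/-- A finite independence set contains an independence set of proportional size after one member of
the tuple has been cut in two. -/
theorem IsIndepSet.exists_update_inter {A : Fin k → Set X} (i₀ : Fin k) (E : Bool → Set X)
    (hE : E true ∪ E false = univ) {M : ℕ} (hM0 : 0 < M)
    (hM : 4 * ((k : ℝ) - 3 / 4) ^ M < ((k : ℝ) - 1 / 2) ^ M) {F : Finset ℕ} (hF : F.Nonempty)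
    (hind : IsIndepSet T A F) :
    ∃ b, ∃ G ⊆ F, IsIndepSet T (Function.update A i₀ (A i₀ ∩ E b)) G ∧
      F.card ≤ 2 * M * G.card := by
  let e : Fin F.card ↪o ℕ := F.orderEmbOfFin rfl
  have he : ∀ z, e z ∈ F := F.orderEmbOfFin_mem rfl
  let D : Bool → Fin F.card → Fin k → Set X := fun b z i =>
    T^[e z] ⁻¹' Function.update A i₀ (A i₀ ∩ E b) i
  obtain ⟨τ, hτ, hcard⟩ := exists_shatters_card i₀ hM0 hM hF.card_pos
    (fun z i => T^[e z] ⁻¹' A i) D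
    (fun z => by
      simp only [D, Function.update_self, ← preimage_union, ← inter_union_distrib_left, hE,
        inter_univ, subset_rfl])
    (fun b z i hi => by simp [D, hi])
    (fun σ => by
      obtain ⟨y, hy⟩ := hind F hF subset_rfl
        (fun s => if h : ∃ z, e z = s then σ h.choose else i₀)
      refine ⟨y, fun z => ?_⟩
      have hz : ∃ z', e z' = e z := ⟨z, rfl⟩
      have := mem_iInter₂.1 hy (e z) (he z)
      rwa [dif_pos hz, e.injective hz.choose_spec] at this)
  let Z : Bool → Finset (Fin F.card) := fun b => Finset.univ.filter fun z => τ z = some b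
  have hZ : (Finset.univ.filter fun z => τ z ≠ none).card ≤ (Z true).card + (Z false).card := by
    refine (Finset.card_le_card fun z hz => ?_).trans (Finset.card_union_le _ _)
    rw [Finset.mem_filter] at hz
    obtain ⟨b, hb⟩ := Option.ne_none_iff_exists'.1 hz.2
    cases b <;> simp [Z, hb]
  obtain ⟨b, hb⟩ : ∃ b, (Finset.univ.filter fun z => τ z ≠ none).card ≤ 2 * (Z b).card := by
    rcases le_total (Z true).card (Z false).card with h | h
    · exact ⟨false, by omega⟩
    · exact ⟨true, by omega⟩
  refine ⟨b, (Z b).map e.toEmbedding, ?_, ?_, ?_⟩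
  · intro s hs
    obtain ⟨z, -, rfl⟩ := Finset.mem_map.1 hs
    exact he z
  · intro I _ hIG σ
    obtain ⟨y, -, hy⟩ := hτ fun z => σ (e z)
    refine ⟨y, mem_iInter₂.2 fun s hs => ?_⟩
    obtain ⟨z, hz, rfl⟩ := Finset.mem_map.1 (hIG hs)
    exact hy z b (Finset.mem_filter.1 hz).2
  · rw [Finset.card_map]
    calc F.card ≤ M * _ := hcard
      _ ≤ M * (2 * (Z b).card) := Nat.mul_le_mul_left _ hb
      _ = 2 * M * (Z b).card := by ring

/-- Positive density of independence survives for one of the two parts when one member of the tuple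
is cut in two. -/
theorem HasIndepSetPosDensity.exists_update_inter {A : Fin k → Set X}
    (h : HasIndepSetPosDensity T A) (i₀ : Fin k) (E : Bool → Set X)
    (hE : E true ∪ E false = univ) :
    ∃ b, HasIndepSetPosDensity T (Function.update A i₀ (A i₀ ∩ E b)) := by
  obtain ⟨J, hJ, c, hc, hev⟩ := h.eventually_count
  obtain ⟨M, hM0, hM⟩ := exists_pow_gap k i₀.pos
  have hM0' : (0 : ℝ) < M := by exact_mod_cast hM0
  have hall : ∀ᶠ n : ℕ in atTop, ∃ b, ∃ K,
      IsIndepSet T (Function.update A i₀ (A i₀ ∩ E b)) K ∧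
        c / (2 * M) * n ≤ Nat.count (· ∈ K) n := by
    filter_upwards [hev, eventually_gt_atTop 0] with n hn hn0
    set F := (Finset.range n).filter (· ∈ J)
    rw [Nat.count_eq_card_filter_range] at hn
    have hn0' : (0 : ℝ) < n := by exact_mod_cast hn0
    have hF : F.Nonempty := by
      rw [← Finset.card_pos]
      exact_mod_cast (by positivity : 0 < c * n).trans_le hn
    have hFind : IsIndepSet T A F :=
      (isShiftProperty_isIndepSet T A).mono (fun s hs => (Finset.mem_filter.1 hs).2) hJ
    obtain ⟨b, G, hGF, hG, hcard⟩ := hFind.exists_update_inter i₀ E hE hM0 hM hF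
    refine ⟨b, G, hG, ?_⟩
    have hGc : ∀ K : Set ℕ, K = G → Nat.count (· ∈ K) n = G.card := by
      rintro K rfl
      rw [Nat.count_eq_card_filter_range]
      congr 1
      ext s
      simp only [Finset.mem_filter, Finset.mem_coe, and_iff_right_iff_imp]
      exact fun hs => (Finset.mem_filter.1 (hGF hs)).1
    rw [hGc _ rfl, div_mul_eq_mul_div, div_le_iff₀ (by positivity), mul_comm (G.card : ℝ)]
    exact hn.trans (by exact_mod_cast hcard)
  have hfreq : ∃ b, ∃ᶠ n : ℕ in atTop, ∃ K,
      IsIndepSet T (Function.update A i₀ (A i₀ ∩ E b)) K ∧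
        c / (2 * M) * n ≤ Nat.count (· ∈ K) n := by
    by_contra hno
    rw [not_exists] at hno
    obtain ⟨n, ⟨b, hb⟩, ht, hf⟩ := (hall.and
      ((not_frequently.1 (hno true)).and (not_frequently.1 (hno false)))).exists
    cases b
    · exact hf hb
    · exact ht hb
  obtain ⟨b, hb⟩ := hfreq
  exact ⟨b, (isShiftProperty_isIndepSet T _).exists_hasPosDensity (by positivity) hb⟩

theorem HasIndepSetPosDensity.exists_refinement {ι : Type*} {A : Fin k → Set X}
    (h : HasIndepSetPosDensity T A) (V : ι → Fin k → Set X) (s : Finset (ι × Fin k)) :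
    ∃ B : Fin k → Set X, (∀ j, B j ⊆ A j) ∧ HasIndepSetPosDensity T B ∧
      ∀ p ∈ s, B p.2 ⊆ V p.1 p.2 ∨ B p.2 ⊆ (V p.1 p.2)ᶜ := by
  induction s using Finset.induction_on with
  | empty => exact ⟨A, fun _ => subset_rfl, h, by simp⟩
  | insert p s _ ih =>
    obtain ⟨B, hBA, hB, hs⟩ := ih
    obtain ⟨b, hb⟩ := hB.exists_update_inter p.2
      (fun b => cond b (V p.1 p.2) (V p.1 p.2)ᶜ) (union_compl_self _)
    have hle : ∀ j, Function.update B p.2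
        (B p.2 ∩ cond b (V p.1 p.2) (V p.1 p.2)ᶜ) j ⊆ B j := by
      intro j
      by_cases hj : j = p.2
      · subst hj
        rw [Function.update_self]
        exact inter_subset_left
      · rw [Function.update_of_ne hj]
    refine ⟨_, fun j => (hle j).trans (hBA j), hb, fun q hq => ?_⟩
    rcases Finset.mem_insert.1 hq with rfl | hq
    · rw [Function.update_self]
      cases b
      · exact Or.inr inter_subset_right
      · exact Or.inl inter_subset_right
    · exact (hs q hq).imp (hle _).trans (hle _).trans

end Independence

/-- Proposition `P-basic E`(1). -/
theorem stmt4 {X : Type*} [TopologicalSpace X] [CompactSpace X] [T2Space X]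
    (T : X → X) (hT : Continuous T) (hTsurj : Function.Surjective T)
    {k : ℕ} (A : Fin k → Set X) (hA : ∀ j, IsClosed (A j))
    (h : HasIndepSetPosDensity T A) :
    ∃ x : Fin k → X, (∀ j, x j ∈ A j) ∧ IsIETuple T x := by
  classical
  by_contra! hcon
  have hcon' : ∀ x : Fin k → X, ∃ U : Fin k → Set X, (∀ i, IsOpen (U i)) ∧ (∀ i, x i ∈ U i) ∧
      ((∀ j, x j ∈ A j) → ¬ HasIndepSetPosDensity T U) := by
    intro x
    by_cases hx : ∀ j, x j ∈ A j
    · have := hcon x hx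
      unfold IsIETuple at this
      push Not at this
      obtain ⟨U, hU, hxU, hn⟩ := this
      exact ⟨U, hU, hxU, fun _ => hn⟩
    · exact ⟨fun _ => univ, fun _ => isOpen_univ, fun _ => mem_univ _, fun h => absurd h hx⟩
  choose U hU hxU hn using hcon'
  have hcomp : IsCompact (univ.pi A) := isCompact_univ_pi fun j => (hA j).isCompact
  obtain ⟨t, htA, ht⟩ := hcomp.elim_nhds_subcover (fun x => univ.pi (U x)) fun x _ =>
    (isOpen_set_pi finite_univ fun i _ => hU x i).mem_nhds fun i _ => hxU x i
  obtain ⟨B, hBA, hB, hs⟩ := h.exists_refinement U (t ×ˢ Finset.univ)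
  choose y hy using hB.nonempty
  obtain ⟨x, hxt, hyx⟩ := mem_iUnion₂.1 (ht fun j _ => hBA j (hy j))
  refine hn x (fun j => htA x hxt j (mem_univ j)) (hB.mono fun j => ?_)
  refine (hs (x, j) (by simp [hxt])).resolve_right fun hsub => ?_
  exact hsub (hy j) (hyx j (mem_univ j))
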